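/- For every integer n ≥ 2, every decision tree over the index set P_n that computes the 2-reachability function f_n has depth at least n − 1. -/

import Mathlib

/-- Decision trees over an index set `ι`. -/
inductive DTree (ι : Type*) where
  | leaf : Bool → DTree ι
  | node : ι → DTree ι → DTree ι → DTree ι

/-- Evaluation of a decision tree on an input. -/
def DTree.eval {ι : Type*} : DTree ι → (ι → Bool) → Bool
  | .leaf b, _ => b
  | .node i t0 t1, x => if x i then t1.eval x else t0.eval x

/-- Depth of a decision tree: the maximum number of internal nodes on a root-to-leaf path. -/
def DTree.depth {ι : Type*} : DTree ι → ℕ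
  | .leaf _ => 0
  | .node _ t0 t1 => max t0.depth t1.depth + 1

/-- `P_n`: unordered pairs of distinct elements of the `n`-element vertex set. -/
abbrev EdgeIx (n : ℕ) := {p : Sym2 (Fin n) // ¬ p.IsDiag}

/-- Read an assignment `x : P_n → {0,1}` at an arbitrary unordered pair. -/
def xe {n : ℕ} (x : EdgeIx n → Bool) (p : Sym2 (Fin n)) : Bool :=
  if h : p.IsDiag then false else x ⟨p, h⟩

/-- Vertex `1`. -/
def vone (n : ℕ) (hn : 2 ≤ n) : Fin n := ⟨0, by omega⟩

/-- Vertex `n`. -/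
def vlast (n : ℕ) (hn : 2 ≤ n) : Fin n := ⟨n - 1, by omega⟩

/-- The 2-reachability function `f_n`. -/
def fReach (n : ℕ) (hn : 2 ≤ n) (x : EdgeIx n → Bool) : Bool :=
  xe x s(vone n hn, vlast n hn) ||
    decide (∃ v : Fin n, v ≠ vone n hn ∧ v ≠ vlast n hn ∧
      xe x s(vone n hn, v) = true ∧ xe x s(v, vlast n hn) = true)

/-- The sensitivity of the function computed by a decision tree at any input is at most the depth
of the tree. -/
theorem DTree.card_le_depth_of_sensitive {ι : Type*} [DecidableEq ι] (T : DTree ι) (x : ι → Bool)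
    (S : Finset ι) (hS : ∀ i ∈ S, T.eval (Function.update x i (!x i)) ≠ T.eval x) :
    S.card ≤ T.depth := by
  induction T generalizing S with
  | leaf b =>
    have : S = ∅ := Finset.eq_empty_of_forall_notMem fun i hi => hS i hi rfl
    simp [this]
  | node i t0 t1 ih0 ih1 =>
    have hcard : S.card - 1 ≤ (S.erase i).card := Finset.pred_card_le_card_erase
    have heval : ∀ j ∈ S.erase i, Function.update x j (!x j) i = x i := fun j hj =>
      Function.update_of_ne (Finset.ne_of_mem_erase hj).symm _ _
    simp only [DTree.depth]
    cases hx : x i with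
    | false =>
      have := ih0 (S.erase i) fun j hj => by
        simpa [DTree.eval, heval j hj, hx] using hS j (Finset.mem_of_mem_erase hj)
      omega
    | true =>
      have := ih1 (S.erase i) fun j hj => by
        simpa [DTree.eval, heval j hj, hx] using hS j (Finset.mem_of_mem_erase hj)
      omega

/-- The star at `a` with the edge to `b` removed. -/
def starAvoiding {n : ℕ} (a b : Fin n) (e : EdgeIx n) : Bool :=
  decide (a ∈ e.1 ∧ b ∉ e.1)

theorem vone_ne_vlast (n : ℕ) (hn : 2 ≤ n) : vone n hn ≠ vlast n hn := by
  simp only [vone, vlast, ne_eq, Fin.mk.injEq]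
  omega

theorem xe_of_ne {n : ℕ} (x : EdgeIx n → Bool) {u v : Fin n} (h : u ≠ v) :
    xe x s(u, v) = x ⟨s(u, v), by simpa using h⟩ := by
  simp [xe, h]

theorem fReach_starAvoiding (n : ℕ) (hn : 2 ≤ n) :
    fReach n hn (starAvoiding (vone n hn) (vlast n hn)) = false := by
  have hlast : ∀ v, xe (starAvoiding (vone n hn) (vlast n hn)) s(v, vlast n hn) = false := by
    intro v
    simp [xe, starAvoiding]
  simp [fReach, hlast]

/-- Adding any edge at the last vertex to the star makes that vertex reachable. -/
theorem fReach_update_starAvoiding (n : ℕ) (hn : 2 ≤ n) (v : Fin n) (hv : v ≠ vlast n hn) :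
    fReach n hn (Function.update (starAvoiding (vone n hn) (vlast n hn))
      ⟨s(v, vlast n hn), by simpa using hv⟩ true) = true := by
  have hne := vone_ne_vlast n hn
  by_cases h1 : v = vone n hn
  · subst h1
    simp [fReach, xe_of_ne _ hne]
  · have hother : xe (Function.update (starAvoiding (vone n hn) (vlast n hn))
        ⟨s(v, vlast n hn), by simpa using hv⟩ true) s(vone n hn, v) = true := by
      rw [xe_of_ne _ (Ne.symm h1), Function.update_of_ne]
      · simp [starAvoiding, hne.symm, Ne.symm hv]
      · simp [hne, Ne.symm h1]
    simp only [fReach, Bool.or_eq_true, decide_eq_true_eq]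
    exact Or.inr ⟨v, h1, hv, hother, by simp [xe_of_ne _ hv]⟩

/-- Every decision tree over `P_n` computing the 2-reachability function `f_n`
has depth at least `n − 1`. -/
theorem dtree_depth_lower_bound (n : ℕ) (hn : 2 ≤ n) (T : DTree (EdgeIx n))
    (hcomp : ∀ x : EdgeIx n → Bool, T.eval x = fReach n hn x) :
    n - 1 ≤ T.depth := by
  let edge : {v : Fin n // v ≠ vlast n hn} → EdgeIx n :=
    fun v => ⟨s(v.1, vlast n hn), by simpa using v.2⟩
  have hinj : Function.Injective edge := fun u v h =>
    Subtype.ext (Sym2.congr_left.mp (congrArg Subtype.val h))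
  have hcard : (Finset.univ.image edge).card = n - 1 := by
    rw [Finset.card_image_of_injective _ hinj, Finset.card_univ, Fintype.card_subtype_compl]
    simp
  rw [← hcard]
  refine T.card_le_depth_of_sensitive (starAvoiding (vone n hn) (vlast n hn)) _ fun i hi => ?_
  obtain ⟨v, -, rfl⟩ := Finset.mem_image.mp hi
  have hfalse : starAvoiding (vone n hn) (vlast n hn) (edge v) = false := by
    simp [starAvoiding, edge]
  rw [hcomp, hcomp, hfalse, fReach_starAvoiding, Bool.not_false,
    fReach_update_starAvoiding n hn v.1 v.2]
  simp
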